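/- arXiv:2311.07266 — 2 statements merged into one kernel-verified Lean document; each statement's English description precedes it below -/
import Mathlib

section
/- With the notation of the n-qubit Hardy construction: let ψ ∈ H be a unit vector orthogonal to S, where S is the linear span of φ₋ together with all φ_x for choice functions x : Fin n → {0,+} with x ∉ {𝟎, 𝟏⁺}. Then the Hardy success probability satisfies |⟨ψ, φ_𝟎⟩|² = (∏_{i=1}^{n} |α i|² |β i|²) / (1 − ∏_{i=1}^{n} |α i|²); in particular this quantity is strictly positive. -/
noncomputable section

namespace Hardy

/-- `|0⟩` : the indicator of `false`, identifying `ℂ²` with `Bool → ℂ`. -/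
def ket0 : Bool → ℂ := fun t => if t then 0 else 1

/-- `|+⟩ = a·|0⟩ + b·|1⟩`. -/
def ketP (a b : ℂ) : Bool → ℂ := fun t => if t then b else a

/-- `|−⟩ = conj b ·|0⟩ − conj a ·|1⟩`. -/
def ketM (a b : ℂ) : Bool → ℂ :=
  fun t => if t then -(starRingEnd ℂ a) else (starRingEnd ℂ b)

/-- The product vector `φ_x` for a choice function `x : Fin n → Bool`
(`x i = false` encodes the `0`-choice, `x i = true` the `+`-choice):
`φ_x (b) = ∏ i, cᵢ (b i)` with `cᵢ = |0⟩` if `x i = 0` and `cᵢ = |+⟩ᵢ` if `x i = +`. -/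
def phi {n : ℕ} (α β : Fin n → ℂ) (x : Fin n → Bool) :
    EuclideanSpace ℂ (Fin n → Bool) :=
  (WithLp.equiv 2 _).symm fun b =>
    ∏ i, (if x i then ketP (α i) (β i) (b i) else ket0 (b i))

/-- The product vector `φ₋ = |−⟩₁ ⊗ ⋯ ⊗ |−⟩ₙ`. -/
def phiMinus {n : ℕ} (α β : Fin n → ℂ) : EuclideanSpace ℂ (Fin n → Bool) :=
  (WithLp.equiv 2 _).symm fun b => ∏ i, ketM (α i) (β i) (b i)

/-- The subspace `S` spanned by `φ₋` together with the `φ_x` for all choice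
functions `x ∉ {𝟎, 𝟏⁺}`. -/
def hardySpan {n : ℕ} (α β : Fin n → ℂ) :
    Submodule ℂ (EuclideanSpace ℂ (Fin n → Bool)) :=
  Submodule.span ℂ
    ({phiMinus α β} ∪
      {v | ∃ x : Fin n → Bool,
        x ≠ (fun _ => false) ∧ x ≠ (fun _ => true) ∧ v = phi α β x})

end Hardy

open Hardy

namespace Hardy

variable {n : ℕ}

lemma phi_apply (α β : Fin n → ℂ) (x b : Fin n → Bool) :
    phi α β x b = ∏ i, (if x i then ketP (α i) (β i) (b i) else ket0 (b i)) := rfl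

lemma phiMinus_apply (α β : Fin n → ℂ) (b : Fin n → Bool) :
    phiMinus α β b = ∏ i, ketM (α i) (β i) (b i) := rfl

lemma inner_eq_sum (ψ φ : EuclideanSpace ℂ (Fin n → Bool)) :
    inner ℂ ψ φ = ∑ b, starRingEnd ℂ (ψ b) * φ b := by
  simp [PiLp.inner_apply, mul_comm]

lemma sum_prod_bool {R : Type*} [CommSemiring R] (f : Fin n → Bool → R) :
    ∑ b : Fin n → Bool, ∏ i, f i (b i) = ∏ i, (f i true + f i false) := by
  simp only [← Fintype.sum_bool, Fintype.prod_sum]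

lemma phi_eq_zero_of_not_le (α β : Fin n → ℂ) {x b : Fin n → Bool} (h : ¬ b ≤ x) :
    phi α β x b = 0 := by
  rw [Pi.le_def] at h
  push Not at h
  obtain ⟨i, hi⟩ := h
  rw [phi_apply]
  refine Finset.prod_eq_zero (Finset.mem_univ i) ?_
  obtain ⟨hx, hb⟩ : x i = false ∧ b i = true := by
    revert hi; cases x i <;> cases b i <;> simp
  simp [hx, hb, ket0]

lemma phi_self_ne_zero (α : Fin n → ℂ) {β : Fin n → ℂ} (hβ : ∀ i, β i ≠ 0)
    (x : Fin n → Bool) : phi α β x x ≠ 0 := by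
  rw [phi_apply, Finset.prod_ne_zero_iff]
  intro i _
  cases h : x i <;> simp [ket0, ketP, hβ]

/-- The amplitude ratio of the Hardy state at one qubit. -/
def ratio (a b : ℂ) : Bool → ℂ := fun t => if t then -a / b else 1

lemma sum_ratio_mul_phi (α : Fin n → ℂ) {β : Fin n → ℂ} (hβ : ∀ i, β i ≠ 0)
    {x : Fin n → Bool} (hx : x ≠ fun _ => false) :
    ∑ b, (∏ i, ratio (α i) (β i) (b i)) * phi α β x b = 0 := by
  obtain ⟨i, hi⟩ := Function.ne_iff.1 hx
  simp only [phi_apply, ← Finset.prod_mul_distrib]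
  rw [sum_prod_bool fun i t =>
    ratio (α i) (β i) t * (if x i then ketP (α i) (β i) t else ket0 t)]
  refine Finset.prod_eq_zero (Finset.mem_univ i) ?_
  have := hβ i
  simp only [Bool.not_eq_false] at hi
  simp [hi, ratio, ketP]
  field_simp
  ring

/-- A function orthogonal to all `φ_x`, `x ∉ {𝟎, 𝟏⁺}`, is a product away from the all-true
point. -/
lemma eq_mul_prod_ratio (α : Fin n → ℂ) {β : Fin n → ℂ} (hβ : ∀ i, β i ≠ 0)
    (g : (Fin n → Bool) → ℂ)
    (hg : ∀ x : Fin n → Bool, x ≠ (fun _ => false) → x ≠ (fun _ => true) →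
      ∑ b, g b * phi α β x b = 0)
    (x : Fin n → Bool) (hx : x ≠ fun _ => true) :
    g x = g (fun _ => false) * ∏ i, ratio (α i) (β i) (x i) := by
  induction x using WellFoundedLT.induction with
  | ind x ih =>
  by_cases h0 : x = fun _ => false
  · simp [h0, ratio]
  have hsum : ∑ b, (g b - g (fun _ => false) * ∏ i, ratio (α i) (β i) (b i)) *
      phi α β x b = 0 := by
    simp only [sub_mul, Finset.sum_sub_distrib, hg x h0 hx, mul_assoc, ← Finset.mul_sum,
      sum_ratio_mul_phi α hβ h0]
    simp
  rw [Finset.sum_eq_single x] at hsum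
  · exact sub_eq_zero.1 ((mul_eq_zero.1 hsum).resolve_right (phi_self_ne_zero α hβ x))
  · intro b _ hb
    by_cases hle : b ≤ x
    · have hlt : b < x := lt_of_le_of_ne hle hb
      have hbt : b ≠ fun _ => true := by
        rintro rfl
        exact not_lt_of_ge (fun i => Bool.le_true (x i)) hlt
      rw [ih b hlt hbt, sub_self, zero_mul]
    · rw [phi_eq_zero_of_not_le α β hle, mul_zero]
  · simp

lemma sum_ratio_mul_phiMinus (α β : Fin n → ℂ) (hβ : ∀ i, β i ≠ 0)
    (hnorm : ∀ j, ‖α j‖ ^ 2 + ‖β j‖ ^ 2 = 1) :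
    ∑ b, (∏ i, ratio (α i) (β i) (b i)) * phiMinus α β b = (∏ i, β i)⁻¹ := by
  simp only [phiMinus_apply, ← Finset.prod_mul_distrib]
  rw [sum_prod_bool fun i t => ratio (α i) (β i) t * ketM (α i) (β i) t,
    ← Finset.prod_inv_distrib]
  refine Finset.prod_congr rfl fun i _ => ?_
  have h1 := hβ i
  have h2 : α i * starRingEnd ℂ (α i) + β i * starRingEnd ℂ (β i) = 1 := by
    rw [Complex.mul_conj', Complex.mul_conj']
    exact_mod_cast hnorm i
  simp only [ratio, ketM, if_true, Bool.false_eq_true, if_false]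
  field_simp
  linear_combination h2

lemma sum_norm_sq_prod_ratio (α β : Fin n → ℂ) (hβ : ∀ i, β i ≠ 0)
    (hnorm : ∀ j, ‖α j‖ ^ 2 + ‖β j‖ ^ 2 = 1) :
    ∑ b : Fin n → Bool, ‖∏ i, ratio (α i) (β i) (b i)‖ ^ 2 = (∏ i, ‖β i‖ ^ 2)⁻¹ := by
  simp only [norm_prod, ← Finset.prod_pow]
  rw [sum_prod_bool fun i t => ‖ratio (α i) (β i) t‖ ^ 2, ← Finset.prod_inv_distrib]
  refine Finset.prod_congr rfl fun i _ => ?_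
  have h1 : ‖β i‖ ≠ 0 := norm_ne_zero_iff.2 (hβ i)
  simp only [ratio, if_true, Bool.false_eq_true, if_false, norm_div, norm_neg, norm_one]
  field_simp
  linear_combination hnorm i

/-- A sum whose terms agree with `f` except at one point. -/
lemma sum_eq_of_eq_off {ι R : Type*} [Fintype ι] [DecidableEq ι] [AddCommGroup R]
    (f g : ι → R) (a : ι) (h : ∀ b, b ≠ a → g b = f b) :
    ∑ b, g b = ∑ b, f b + (g a - f a) := by
  rw [← sub_eq_iff_eq_add', ← Finset.sum_sub_distrib]
  exact Finset.sum_eq_single a (fun b _ hb => sub_eq_zero.2 (h b hb)) (by simp)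

end Hardy

/-- **The Hardy success probability of the Hardy state.**
If `ψ` is a unit vector orthogonal to `S = hardySpan α β`, then
`|⟨ψ, φ_𝟎⟩|² = (∏ᵢ |αᵢ|²|βᵢ|²) / (1 − ∏ᵢ |αᵢ|²)`, and this quantity is
strictly positive. -/
theorem hardy_success_probability (n : ℕ) (α β : Fin n → ℂ)
    (hnorm : ∀ j, ‖α j‖ ^ 2 + ‖β j‖ ^ 2 = 1)
    (hα : ∀ j, 0 < ‖α j‖ ∧ ‖α j‖ < 1)
    (ψ : EuclideanSpace ℂ (Fin n → Bool))
    (hψ : ‖ψ‖ = 1) (hmem : ψ ∈ (hardySpan α β)ᗮ) :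
    ‖(inner ℂ ψ (phi α β fun _ => false) : ℂ)‖ ^ 2 =
        (∏ i, ‖α i‖ ^ 2 * ‖β i‖ ^ 2) /
          (1 - ∏ i, ‖α i‖ ^ 2) ∧
      0 < ‖(inner ℂ ψ (phi α β fun _ => false) : ℂ)‖ ^ 2 := by
  have hβ : ∀ i, β i ≠ 0 := fun i h => by
    have h1 := hnorm i
    have h2 := hα i
    rw [h, norm_zero] at h1
    nlinarith
  have hmem' := (Submodule.mem_orthogonal' _ _).1 hmem
  set g : (Fin n → Bool) → ℂ := fun b => starRingEnd ℂ (ψ b) with hg_def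
  have hinner : ∀ φ, inner ℂ ψ φ = ∑ b, g b * φ b := inner_eq_sum ψ
  have hg := eq_mul_prod_ratio α hβ g fun x h0 h1 => by
    rw [← hinner]
    exact hmem' _ (Submodule.subset_span (Or.inr ⟨x, h0, h1, rfl⟩))
  have hs : inner ℂ ψ (phi α β fun _ => false) = g fun _ => false := by
    rw [hinner, Finset.sum_eq_single fun _ => false]
    · simp [phi_apply, ket0]
    · intro b _ hb
      have hle : ¬ b ≤ fun _ => false := fun h =>
        hb (le_antisymm h fun i => Bool.false_le (b i))
      rw [phi_eq_zero_of_not_le α β hle, mul_zero]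
    · simp
  rw [hs]
  set s := g fun _ => false
  set t := g fun _ => true
  have hM : ∑ b, g b * phiMinus α β b = 0 := by
    rw [← hinner]
    exact hmem' _ (Submodule.subset_span (Or.inl rfl))
  have hN : ∑ b, ‖g b‖ ^ 2 = 1 := by
    have h := EuclideanSpace.norm_sq_eq ψ
    rw [hψ] at h
    simpa [hg_def] using h.symm
  rw [sum_eq_of_eq_off (fun b => s * ((∏ i, ratio (α i) (β i) (b i)) * phiMinus α β b)) _
    (fun _ => true) fun b hb => by rw [hg b hb, mul_assoc],
    ← Finset.mul_sum, sum_ratio_mul_phiMinus α β hβ hnorm] at hM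
  rw [sum_eq_of_eq_off (fun b => ‖s‖ ^ 2 * ‖∏ i, ratio (α i) (β i) (b i)‖ ^ 2) _
    (fun _ => true) fun b hb => by rw [hg b hb, norm_mul, mul_pow],
    ← Finset.mul_sum, sum_norm_sq_prod_ratio α β hβ hnorm] at hN
  simp only [phiMinus_apply, ratio, ketM, if_true, Finset.prod_div_distrib, norm_div,
    norm_prod, norm_neg, div_pow, ← Finset.prod_pow] at hM hN
  rw [Finset.prod_mul_distrib]
  set A := ∏ i, ‖α i‖ ^ 2 with hA
  set B := ∏ i, ‖β i‖ ^ 2 with hB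
  have hApos : 0 < A := Finset.prod_pos fun i _ => pow_pos (hα i).1 2
  have hBpos : 0 < B := Finset.prod_pos fun i _ => pow_pos (norm_pos_iff.2 (hβ i)) 2
  have hQ : ∏ i, β i ≠ 0 := Finset.prod_ne_zero_iff.2 fun i _ => hβ i
  have hWR : (∏ i, -α i) * ∏ i, -starRingEnd ℂ (α i) = (A : ℂ) := by
    rw [← Finset.prod_mul_distrib, hA]
    push_cast
    exact Finset.prod_congr rfl fun i _ => by rw [neg_mul_neg, Complex.mul_conj']
  have ht : t * (∏ i, β i) * (∏ i, -starRingEnd ℂ (α i)) = s * ((A - 1 : ℝ) : ℂ) := by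
    push_cast
    rw [← hWR]
    field_simp at hM
    linear_combination hM
  have ht' : ‖t‖ ^ 2 * B * A = ‖s‖ ^ 2 * (A - 1) ^ 2 := by
    have h := congrArg (fun z : ℂ => ‖z‖ ^ 2) ht
    simpa only [norm_mul, mul_pow, norm_prod, norm_neg, RCLike.norm_conj, ← Finset.prod_pow,
      Complex.norm_real, Real.norm_eq_abs, sq_abs] using h
  have key : ‖s‖ ^ 2 * (1 - A) = A * B := by
    field_simp at hN
    linear_combination A * hN - ht'
  have hA1 : 1 - A ≠ 0 := fun h => by
    rw [h, mul_zero] at key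
    exact (mul_pos hApos hBpos).ne key
  refine ⟨(eq_div_iff hA1).2 key, ?_⟩
  refine lt_of_le_of_ne (sq_nonneg _) fun h => ?_
  rw [← h, zero_mul] at key
  exact (mul_pos hApos hBpos).ne key
end
end

section
/- With the notation of the n-qubit Hardy construction (n ≥ 2): let t be the unique real number in (0,1) with ∑_{k=1}^{n} t^k = 1. For every choice of parameters α, β : Fin n → ℂ with |α j|² + |β j|² = 1 and 0 < |α j| < 1 for all j, and every unit vector ψ ∈ H orthogonal to S (where S is the linear span of φ₋ together with all φ_x for x ∉ {𝟎, 𝟏⁺}), the Hardy success probability satisfies |⟨ψ, φ_𝟎⟩|² ≤ t^n (1−t)^n / (1 − t^n). -/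
noncomputable section

open Hardy

namespace Hardy

/-- The tensor product of the single-qubit vectors `u i`. -/
def prodVec {n : ℕ} (u : Fin n → Bool → ℂ) : EuclideanSpace ℂ (Fin n → Bool) :=
  (WithLp.equiv 2 _).symm fun b => ∏ i, u i (b i)

theorem prodVec_apply {n : ℕ} (u : Fin n → Bool → ℂ) (b : Fin n → Bool) :
    prodVec u b = ∏ i, u i (b i) := rfl

theorem norm_prodVec_sq {n : ℕ} (u : Fin n → Bool → ℂ) :
    ‖prodVec u‖ ^ 2 = ∏ i, (‖u i true‖ ^ 2 + ‖u i false‖ ^ 2) := by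
  rw [EuclideanSpace.norm_sq_eq]
  have h := Finset.prod_univ_sum (fun _ : Fin n => (Finset.univ : Finset Bool))
    (fun i b => ‖u i b‖ ^ 2)
  rw [Fintype.piFinset_univ] at h
  simp only [Fintype.sum_bool] at h
  rw [h]
  refine Finset.sum_congr rfl fun b _ => ?_
  rw [prodVec_apply, norm_prod, Finset.prod_pow]

/-- Multilinear expansion of a product vector in the product basis built from `|0⟩` and `|+⟩`. -/
theorem prodVec_eq_sum_phi {n : ℕ} (α β p q : Fin n → ℂ) :
    prodVec (fun i b => p i * ket0 b + q i * ketP (α i) (β i) b) =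
      ∑ x : Fin n → Bool, (∏ i, if x i then q i else p i) • phi α β x := by
  ext b
  have h := Finset.prod_univ_sum (fun _ : Fin n => (Finset.univ : Finset Bool))
    (fun i c => (if c then q i else p i) *
      (if c then ketP (α i) (β i) (b i) else ket0 (b i)))
  rw [Fintype.piFinset_univ] at h
  simp only [Fintype.sum_bool, if_true, Bool.false_eq_true, if_false] at h
  simp only [prodVec_apply, WithLp.ofLp_sum, Finset.sum_apply, PiLp.smul_apply, smul_eq_mul]
  rw [Finset.prod_congr rfl fun i _ => add_comm (p i * ket0 (b i)) _, h]
  refine Finset.sum_congr rfl fun x _ => ?_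
  rw [Finset.prod_mul_distrib]
  rfl

theorem inner_prodVec_of_mem_orthogonal {n : ℕ} (hn : n ≠ 0) (α β p q : Fin n → ℂ)
    {ψ : EuclideanSpace ℂ (Fin n → Bool)} (hmem : ψ ∈ (hardySpan α β)ᗮ) :
    inner ℂ ψ (prodVec fun i b => p i * ket0 b + q i * ketP (α i) (β i) b) =
      (∏ i, p i) * inner ℂ ψ (phi α β fun _ => false) +
        (∏ i, q i) * inner ℂ ψ (phi α β fun _ => true) := by
  have hne : (fun _ : Fin n => false) ≠ fun _ => true := fun h =>
    Bool.false_ne_true (congrFun h ⟨0, Nat.pos_of_ne_zero hn⟩)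
  rw [prodVec_eq_sum_phi, inner_sum, Fintype.sum_eq_add _ _ hne]
  · simp [inner_smul_right]
  · rintro x ⟨h0, h1⟩
    rw [inner_smul_right, (Submodule.mem_orthogonal' _ _).1 hmem _
      (Submodule.subset_span (Or.inr ⟨x, h0, h1, rfl⟩)), mul_zero]

theorem normSq_inner_phi_zero_le {n : ℕ} (hn : n ≠ 0) (α β : Fin n → ℂ)
    (hnorm : ∀ j, ‖α j‖ ^ 2 + ‖β j‖ ^ 2 = 1) (hα : ∀ j, ‖α j‖ < 1)
    {ψ : EuclideanSpace ℂ (Fin n → Bool)} (hψ : ‖ψ‖ = 1) (hmem : ψ ∈ (hardySpan α β)ᗮ) :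
    ‖(inner ℂ ψ (phi α β fun _ => false) : ℂ)‖ ^ 2 * (1 - ∏ i, ‖α i‖ ^ 2) ≤
      (∏ i, ‖α i‖ ^ 2) * ∏ i, (1 - ‖α i‖ ^ 2) := by
  have hmul (j) : β j * starRingEnd ℂ (β j) + α j * starRingEnd ℂ (α j) = 1 := by
    rw [Complex.mul_conj', Complex.mul_conj', add_comm]
    exact_mod_cast hnorm j
  set e : EuclideanSpace ℂ (Fin n → Bool) := EuclideanSpace.single (fun _ => true) 1 with he
  set A : ℂ := ∏ i, -starRingEnd ℂ (α i) with hA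
  set B : ℂ := ∏ i, β i with hB
  set a : ℝ := ∏ i, ‖α i‖ ^ 2 with ha
  have hAA : A * ∏ i, -α i = a := by
    rw [hA, ha, ← Finset.prod_mul_distrib, Complex.ofReal_prod]
    refine Finset.prod_congr rfl fun i _ => ?_
    rw [neg_mul_neg, mul_comm, Complex.mul_conj']
    push_cast
    rfl
  have hnA : ‖A‖ ^ 2 = a := by
    rw [hA, ha, norm_prod, ← Finset.prod_pow]
    simp
  have hnB : ‖B‖ ^ 2 = ∏ i, (1 - ‖α i‖ ^ 2) := by
    rw [hB, norm_prod, ← Finset.prod_pow]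
    exact Finset.prod_congr rfl fun i _ => by linarith [hnorm i]
  have ha1 : a < 1 := by
    have : Nonempty (Fin n) := ⟨⟨0, Nat.pos_of_ne_zero hn⟩⟩
    obtain ⟨j⟩ := this
    have hle : ∀ i, ‖α i‖ ^ 2 ≤ 1 := fun i => by nlinarith [hnorm i, sq_nonneg ‖β i‖]
    rw [ha, ← Finset.mul_prod_erase _ _ (Finset.mem_univ j)]
    have h1 : ∏ i ∈ Finset.univ.erase j, ‖α i‖ ^ 2 ≤ 1 :=
      Finset.prod_le_one (fun _ _ => sq_nonneg _) fun i _ => hle i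
    have h2 : ‖α j‖ ^ 2 < 1 := by nlinarith [hα j, norm_nonneg (α j)]
    nlinarith [sq_nonneg ‖α j‖]
  have hminus : B • phiMinus α β =
      prodVec fun i b => 1 * ket0 b + -starRingEnd ℂ (α i) * ketP (α i) (β i) b := by
    ext b
    simp only [PiLp.smul_apply, smul_eq_mul, prodVec_apply, hB]
    change _ * ∏ i, ketM (α i) (β i) (b i) = _
    rw [← Finset.prod_mul_distrib]
    refine Finset.prod_congr rfl fun i _ => ?_
    cases b i <;> simp only [ketM, ket0, ketP, if_true, Bool.false_eq_true, if_false]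
    · linear_combination hmul i
    · ring
  have hone : B • e =
      prodVec fun i b => -α i * ket0 b + 1 * ketP (α i) (β i) b := by
    ext b
    simp only [PiLp.smul_apply, smul_eq_mul, prodVec_apply, he, PiLp.single_apply]
    by_cases hb : b = fun _ => true
    · subst hb
      simp [ket0, ketP, hB]
    · obtain ⟨i, hi⟩ := Function.ne_iff.1 hb
      rw [if_neg hb, mul_zero, eq_comm]
      refine Finset.prod_eq_zero (Finset.mem_univ i) ?_
      rw [Bool.eq_false_of_not_eq_true hi]
      simp [ket0, ketP]
  have hψm : inner ℂ ψ (phiMinus α β) = 0 :=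
    (Submodule.mem_orthogonal' _ _).1 hmem _ (Submodule.subset_span (Or.inl rfl))
  set P : ℂ := inner ℂ ψ (phi α β fun _ => false) with hP
  have h0 := inner_prodVec_of_mem_orthogonal hn α β (fun _ => 1)
    (fun i => -starRingEnd ℂ (α i)) hmem
  have h1 := inner_prodVec_of_mem_orthogonal hn α β (fun i => -α i) (fun _ => 1) hmem
  rw [← hminus, inner_smul_right, hψm, mul_zero, Finset.prod_const_one, one_mul] at h0
  rw [← hone, inner_smul_right, Finset.prod_const_one, one_mul] at h1
  have hkey : A * B * inner ℂ ψ e = -((1 - a : ℝ) : ℂ) * P := by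
    push_cast
    linear_combination A * h1 + P * hAA - h0
  have hnm : ‖phiMinus α β‖ = 1 := by
    rw [← sq_eq_sq₀ (norm_nonneg _) zero_le_one, one_pow]
    refine (norm_prodVec_sq fun i => ketM (α i) (β i)).trans ?_
    refine Finset.prod_eq_one fun i _ => ?_
    simpa [ketM] using hnorm i
  have hbessel : ‖(inner ℂ ψ e : ℂ)‖ ^ 2 ≤ 1 - a := by
    have hon : Orthonormal ℂ ![ψ, phiMinus α β] := by
      rw [orthonormal_iff_ite]
      intro i j
      fin_cases i <;> fin_cases j <;>
        simp [hψ, hnm, hψm, inner_eq_zero_symm.1 hψm]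
    have h := hon.sum_inner_products_le (x := e) (s := Finset.univ)
    have hme : (inner ℂ (phiMinus α β) e : ℂ) = starRingEnd ℂ A := by
      rw [he, EuclideanSpace.inner_single_right, one_mul]
      change starRingEnd ℂ (∏ i, ketM (α i) (β i) true) = _
      simp [ketM, hA]
    simp only [Fin.sum_univ_two, Matrix.cons_val_zero, Matrix.cons_val_one, hme,
      RCLike.norm_conj, hnA] at h
    rw [he, PiLp.norm_single, norm_one] at h
    linarith
  have hsq : (1 - a) ^ 2 * ‖P‖ ^ 2 = a * ‖B‖ ^ 2 * ‖(inner ℂ ψ e : ℂ)‖ ^ 2 := by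
    have h := congrArg (fun z : ℂ => ‖z‖ ^ 2) hkey
    simp only [norm_mul, norm_neg, Complex.norm_real, mul_pow, hnA, Real.norm_eq_abs,
      sq_abs] at h
    exact h.symm
  rw [← hnB]
  have hab : 0 ≤ a * ‖B‖ ^ 2 := by rw [← hnA]; positivity
  refine le_of_mul_le_mul_left ?_ (sub_pos.2 ha1)
  nlinarith [mul_le_mul_of_nonneg_left hbessel hab]

/-- Symmetrization: replacing all `a i` by their geometric mean increases `∏ (1 - a i)`. -/
theorem exists_geom_mean {n : ℕ} (hn : n ≠ 0) (a : Fin n → ℝ) (h0 : ∀ i, 0 < a i)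
    (h1 : ∀ i, a i < 1) :
    ∃ x ∈ Set.Ioo (0 : ℝ) 1, ∏ i, a i = x ^ n ∧ ∏ i, (1 - a i) ≤ (1 - x) ^ n := by
  have hn' : (n : ℝ) ≠ 0 := Nat.cast_ne_zero.2 hn
  have hpow (z : Fin n → ℝ) (hz : ∀ i, 0 < z i) :
      (∏ i, z i ^ (n : ℝ)⁻¹) ^ n = ∏ i, z i := by
    rw [← Finset.prod_pow]
    exact Finset.prod_congr rfl fun i _ => Real.rpow_inv_natCast_pow (hz i).le hn
  have hamgm (z : Fin n → ℝ) (hz : ∀ i, 0 < z i) :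
      ∏ i, z i ^ (n : ℝ)⁻¹ ≤ ∑ i, (n : ℝ)⁻¹ * z i :=
    Real.geom_mean_le_arith_mean_weighted _ _ _ (fun _ _ => by positivity)
      (by simp [hn']) fun i _ => (hz i).le
  have hb (i) : 0 < 1 - a i := sub_pos.2 (h1 i)
  have hx := hamgm a h0
  have hy := hamgm (fun i => 1 - a i) hb
  have hxpos : 0 < ∏ i, a i ^ (n : ℝ)⁻¹ :=
    Finset.prod_pos fun i _ => Real.rpow_pos_of_pos (h0 i) _
  have hypos : 0 < ∏ i, (1 - a i) ^ (n : ℝ)⁻¹ :=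
    Finset.prod_pos fun i _ => Real.rpow_pos_of_pos (hb i) _
  have hsum : ∑ i, (n : ℝ)⁻¹ * a i + ∑ i, (n : ℝ)⁻¹ * (1 - a i) = 1 := by
    rw [← Finset.sum_add_distrib]
    simp [← mul_add, hn']
  refine ⟨∏ i, a i ^ (n : ℝ)⁻¹, ⟨hxpos, by linarith⟩, (hpow a h0).symm, ?_⟩
  rw [← hpow _ hb]
  exact pow_le_pow_left₀ hypos.le (by linarith) _

theorem hasDerivAt_symmetric_success {n : ℕ} (hn : n ≠ 0) {x : ℝ} (hx : x ∈ Set.Ioo (0 : ℝ) 1) :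
    HasDerivAt (fun y : ℝ => (y * (1 - y)) ^ n / (1 - y ^ n))
      (n * (x * (1 - x)) ^ (n - 1) * (1 - x) * (1 - ∑ k ∈ Finset.Icc 1 n, x ^ k) /
        (1 - x ^ n) ^ 2) x := by
  have hne : 1 - x ^ n ≠ 0 := (sub_pos.2 (pow_lt_one₀ hx.1.le hx.2 hn)).ne'
  have h1 : HasDerivAt (fun y : ℝ => (y * (1 - y)) ^ n)
      (n * (x * (1 - x)) ^ (n - 1) * (1 * (1 - x) + x * (-1))) x :=
    ((hasDerivAt_id x).mul ((hasDerivAt_id x).const_sub 1)).pow n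
  have h2 : HasDerivAt (fun y : ℝ => 1 - y ^ n) (-(n * x ^ (n - 1))) x :=
    (hasDerivAt_pow n x).const_sub 1
  refine (h1.div h2 hne).congr_deriv ?_
  congr 1
  have hgeom : (1 - x) * ∑ k ∈ Finset.Icc 1 n, x ^ k = x - x ^ (n + 1) := by
    have h := mul_neg_geom_sum x n
    rw [← Finset.Ico_succ_right_eq_Icc, Finset.sum_Ico_eq_sum_range]
    simp only [pow_add, ← Finset.mul_sum]
    simp only [Nat.succ_eq_succ, Nat.succ_eq_add_one, Nat.add_sub_cancel]
    linear_combination x * h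
  obtain ⟨m, rfl⟩ := Nat.exists_eq_succ_of_ne_zero hn
  simp only [Nat.succ_eq_add_one, Nat.add_sub_cancel] at hgeom ⊢
  linear_combination (((m + 1 : ℕ) : ℝ) * (x * (1 - x)) ^ m) * hgeom

theorem symmetric_success_le {n : ℕ} (hn : n ≠ 0) {t x : ℝ} (ht : t ∈ Set.Ioo (0 : ℝ) 1)
    (htsum : ∑ k ∈ Finset.Icc 1 n, t ^ k = 1) (hx : x ∈ Set.Ioo (0 : ℝ) 1) :
    (x * (1 - x)) ^ n / (1 - x ^ n) ≤ (t * (1 - t)) ^ n / (1 - t ^ n) := by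
  have hsum {y z : ℝ} (hy : 0 ≤ y) (hyz : y ≤ z) :
      ∑ k ∈ Finset.Icc 1 n, y ^ k ≤ ∑ k ∈ Finset.Icc 1 n, z ^ k :=
    Finset.sum_le_sum fun k _ => pow_le_pow_left₀ hy hyz k
  have hcont {s : Set ℝ} (hs : s ⊆ Set.Ioo 0 1) :
      ContinuousOn (fun y : ℝ => (y * (1 - y)) ^ n / (1 - y ^ n)) s := fun y hy =>
    (hasDerivAt_symmetric_success hn (hs hy)).continuousAt.continuousWithinAt
  have hfac {y : ℝ} (hy : y ∈ Set.Ioo (0 : ℝ) 1) :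
      0 ≤ n * (y * (1 - y)) ^ (n - 1) * (1 - y) := by
    have := sub_pos.2 hy.2
    have := hy.1
    positivity
  rcases le_total x t with h | h
  · have hs : Set.Icc x t ⊆ Set.Ioo (0 : ℝ) 1 := Set.Icc_subset_Ioo hx.1 ht.2
    refine monotoneOn_of_hasDerivWithinAt_nonneg (convex_Icc x t) (hcont hs)
      (fun y hy => (hasDerivAt_symmetric_success hn
        (hs (interior_subset hy))).hasDerivWithinAt) (fun y hy => ?_)
      (Set.left_mem_Icc.2 h) (Set.right_mem_Icc.2 h) h
    have hy' := interior_subset hy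
    have := hsum (hs hy').1.le hy'.2
    exact div_nonneg (mul_nonneg (hfac (hs hy')) (by linarith)) (sq_nonneg _)
  · have hs : Set.Icc t x ⊆ Set.Ioo (0 : ℝ) 1 := Set.Icc_subset_Ioo ht.1 hx.2
    refine antitoneOn_of_hasDerivWithinAt_nonpos (convex_Icc t x) (hcont hs)
      (fun y hy => (hasDerivAt_symmetric_success hn
        (hs (interior_subset hy))).hasDerivWithinAt) (fun y hy => ?_)
      (Set.left_mem_Icc.2 h) (Set.right_mem_Icc.2 h) h
    have hy' := interior_subset hy
    have := hsum ht.1.le hy'.1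
    exact div_nonpos_of_nonpos_of_nonneg
      (mul_nonpos_of_nonneg_of_nonpos (hfac (hs hy')) (by linarith)) (sq_nonneg _)

end Hardy

/-- **Device-relevant upper bound on the Hardy success probability.**
Let `n ≥ 2` and let `t` be the unique number in `(0,1)` with
`∑_{k=1}^n t^k = 1`.  For every choice of parameters `α, β` and every unit
vector `ψ` orthogonal to `S = hardySpan α β`, the Hardy success probability
satisfies `|⟨ψ, φ_𝟎⟩|² ≤ tⁿ(1−t)ⁿ/(1−tⁿ)`. -/
theorem hardy_success_probability_le_max (n : ℕ) (hn : 2 ≤ n)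
    (t : ℝ) (ht : t ∈ Set.Ioo (0 : ℝ) 1)
    (htsum : ∑ k ∈ Finset.Icc 1 n, t ^ k = 1)
    (α β : Fin n → ℂ)
    (hnorm : ∀ j, ‖α j‖ ^ 2 + ‖β j‖ ^ 2 = 1)
    (hα : ∀ j, 0 < ‖α j‖ ∧ ‖α j‖ < 1)
    (ψ : EuclideanSpace ℂ (Fin n → Bool))
    (hψ : ‖ψ‖ = 1) (hmem : ψ ∈ (hardySpan α β)ᗮ) :
    ‖(inner ℂ ψ (phi α β fun _ => false) : ℂ)‖ ^ 2 ≤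
      t ^ n * (1 - t) ^ n / (1 - t ^ n) := by
  have hn0 : n ≠ 0 := by omega
  have hle := normSq_inner_phi_zero_le hn0 α β hnorm (fun j => (hα j).2) hψ hmem
  obtain ⟨x, hx, hprod, hprod'⟩ := exists_geom_mean hn0 (fun i => ‖α i‖ ^ 2)
    (fun i => pow_pos (hα i).1 2) (fun i => pow_lt_one₀ (norm_nonneg _) (hα i).2 two_ne_zero)
  rw [hprod] at hle
  have hpos : 0 < 1 - x ^ n := sub_pos.2 (pow_lt_one₀ hx.1.le hx.2 hn0)
  have hxn : 0 ≤ x ^ n := pow_nonneg hx.1.le n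
  rw [← mul_pow]
  refine le_trans ?_ (symmetric_success_le hn0 ht htsum hx)
  rw [le_div_iff₀ hpos, mul_pow]
  exact hle.trans (mul_le_mul_of_nonneg_left hprod' hxn)
end
end
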